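/- Let b > 0, λ > 0, α ∈ (1,2) and C_α > 0, and let g, F and the coupling operator L* be as defined. Then there exists a constant C > 0 such that for all y > ỹ ≥ 0 and x, x̃ ∈ ℝ, writing u := y − ỹ and v := |x − x̃|: (L*F)(y,ỹ,x,x̃) ≤ −λ·v·1_{{v ≥ 2u}} + C·u + (C/2)·u^{2−α} + (C/2)·(√y + √ỹ)²·u^{−1}·1_{{0 < u < 1}} + (C/2)·(√y − √ỹ)²·u^{−1}·1_{{u ≥ 1}}. -/

import Mathlib

open Set MeasureTheory

/-- The Lévy measure of a spectrally positive `α`-stable process: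
`ν_α(dz) = C_α z^{-(1+α)} 1_{z>0} dz`. -/
noncomputable def nuMeasure (Cα α : ℝ) : Measure ℝ :=
  (volume.restrict (Ioi (0 : ℝ))).withDensity fun z => ENNReal.ofReal (Cα * z ^ (-(1 + α)))

/-- The cutoff function `g` from the paper. -/
def IsCutoff (δ : ℝ) (g : ℝ → ℝ) : Prop :=
  ContDiffOn ℝ 2 g (Ici 0) ∧
  (∃ M : ℝ, ∀ r ∈ Ici (0 : ℝ), |g r| ≤ M ∧ |deriv g r| ≤ M ∧ |deriv (deriv g) r| ≤ M) ∧
  MonotoneOn g (Ici 0) ∧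
  (∀ r ∈ Ici (0 : ℝ), g r ∈ Icc (0 : ℝ) 1) ∧
  (∀ r : ℝ, 0 ≤ r → r ≤ 1 → g r = 0) ∧
  (∀ r : ℝ, 1 < r → r < 3 / 2 → g r = (r - 1) ^ (2 + δ)) ∧
  (∀ r : ℝ, 2 ≤ r → g r = 1)

/-- `F(s,t) = (1 - g(t/s))·s + g(t/s)·t` for `s ≠ 0`, and `F(0,t) = t`. -/
noncomputable def Fcut (g : ℝ → ℝ) (s t : ℝ) : ℝ :=
  if s = 0 then t else (1 - g (t / s)) * s + g (t / s) * t

/-- `V_{c,θ}(s,t) = c(s + s^θ) + F(s,t)`. -/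
noncomputable def Vct (g : ℝ → ℝ) (c θ s t : ℝ) : ℝ :=
  c * (s + s ^ θ) + Fcut g s t

/-- first partial derivative in the first argument -/
noncomputable def D1 (G : ℝ → ℝ → ℝ) (s t : ℝ) : ℝ := deriv (fun a => G a t) s

/-- first partial derivative in the second argument -/
noncomputable def D2 (G : ℝ → ℝ → ℝ) (s t : ℝ) : ℝ := deriv (fun a => G s a) t

/-- second partial derivative in the first argument -/
noncomputable def D11 (G : ℝ → ℝ → ℝ) (s t : ℝ) : ℝ := deriv (fun a => D1 G a t) s

/-- `σ = (x - x̃)/|x - x̃|` for `x ≠ x̃`, and `σ = 1` for `x = x̃`. -/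
noncomputable def sgn' (x xt : ℝ) : ℝ := if x = xt then 1 else (x - xt) / |x - xt|

/-- The coupling operator `L*` (reflection coupling for `u < 1`, synchronous
coupling for `u ≥ 1` in the first component; synchronous coupling in the
second component), acting on `G(u,v)` with `u = y - ỹ`, `v = |x - x̃|`. -/
noncomputable def Lstar (b lam Cα α : ℝ) (G : ℝ → ℝ → ℝ) (y yt x xt : ℝ) : ℝ :=
  -b * (y - yt) * D1 G (y - yt) |x - xt|
    + (1 / 2) * (Real.sqrt y + Real.sqrt yt) ^ 2 * D11 G (y - yt) |x - xt|
        * (if 0 < y - yt ∧ y - yt < 1 then 1 else 0)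
    + (1 / 2) * (Real.sqrt y - Real.sqrt yt) ^ 2 * D11 G (y - yt) |x - xt|
        * (if 1 ≤ y - yt then 1 else 0)
    - lam * |x - xt| * D2 G (y - yt) |x - xt|
    + (y - yt) * ∫ z, (G (y - yt) |x - xt + z| - G (y - yt) |x - xt|
        - D2 G (y - yt) |x - xt| * sgn' x xt * z) ∂(nuMeasure Cα α)

/-- The even profile `ψ` with `F(s,t) = s ψ(t/s)` for `s > 0`, `t ≥ 0`. -/
noncomputable def profile (g : ℝ → ℝ) (w : ℝ) : ℝ := 1 + g |w| * (|w| - 1)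

theorem Fcut_eq_mul_profile (g : ℝ → ℝ) {s t : ℝ} (hs : 0 < s) (ht : 0 ≤ t) :
    Fcut g s t = s * profile g (t / s) := by
  have h : |t / s| = t / s := abs_of_nonneg (by positivity)
  rw [Fcut, if_neg hs.ne', profile, h]
  field_simp
  ring

theorem profile_abs (g : ℝ → ℝ) (w : ℝ) : profile g |w| = profile g w := by
  simp [profile]

theorem deriv_profile_neg (g : ℝ → ℝ) (w : ℝ) :
    deriv (profile g) (-w) = -deriv (profile g) w := by
  have h : (fun x => profile g (-x)) = profile g := by
    funext x
    simp [profile]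
  have h2 := deriv_comp_neg (profile g) w
  rw [h] at h2
  linarith

theorem deriv_profile_zero (g : ℝ → ℝ) : deriv (profile g) 0 = 0 := by
  have h := deriv_profile_neg g 0
  rw [neg_zero] at h
  linarith

theorem hasDerivAt_const_div (t : ℝ) {s : ℝ} (hs : s ≠ 0) :
    HasDerivAt (fun a => t / a) (-t / s ^ 2) s := by
  refine ((hasDerivAt_const s t).div (hasDerivAt_id s) hs).congr_deriv ?_
  simp

namespace IsCutoff

variable {δ : ℝ} {g : ℝ → ℝ}

theorem profile_of_abs_le_one (hg : IsCutoff δ g) {w : ℝ} (hw : |w| ≤ 1) : profile g w = 1 := by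
  obtain ⟨-, -, -, -, h, -⟩ := hg
  simp [profile, h _ (abs_nonneg w) hw]

theorem profile_of_two_le (hg : IsCutoff δ g) {w : ℝ} (hw : 2 ≤ |w|) : profile g w = |w| := by
  obtain ⟨-, -, -, -, -, -, h⟩ := hg
  simp [profile, h _ hw]

theorem contDiff_profile (hg : IsCutoff δ g) : ContDiff ℝ 2 (profile g) := by
  rw [contDiff_iff_contDiffAt]
  intro w
  rcases eq_or_ne w 0 with rfl | hw
  · have h : profile g =ᶠ[nhds 0] fun _ => (1 : ℝ) := by
      filter_upwards [Metric.ball_mem_nhds (0 : ℝ) one_pos] with x hx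
      rw [Metric.mem_ball, dist_zero_right, Real.norm_eq_abs] at hx
      exact hg.profile_of_abs_le_one hx.le
    exact contDiffAt_const.congr_of_eventuallyEq h
  · have h1 : ContDiffAt ℝ 2 (fun x : ℝ => |x|) w := contDiffAt_abs hw
    have h2 : ContDiffAt ℝ 2 g |w| := hg.1.contDiffAt (Ici_mem_nhds (abs_pos.mpr hw))
    exact contDiffAt_const.add ((h2.comp w h1).mul (h1.sub contDiffAt_const))

theorem differentiable_profile (hg : IsCutoff δ g) : Differentiable ℝ (profile g) :=
  hg.contDiff_profile.differentiable (by norm_num)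

theorem contDiff_deriv_profile (hg : IsCutoff δ g) : ContDiff ℝ 1 (deriv (profile g)) := by
  have h : ContDiff ℝ (1 + 1) (profile g) := by
    rw [one_add_one_eq_two]
    exact hg.contDiff_profile
  exact (contDiff_succ_iff_deriv.mp h).2.2

theorem differentiable_deriv_profile (hg : IsCutoff δ g) :
    Differentiable ℝ (deriv (profile g)) :=
  hg.contDiff_deriv_profile.differentiable (by norm_num)

theorem deriv_profile_of_two_lt (hg : IsCutoff δ g) {w : ℝ} (hw : 2 < w) :
    deriv (profile g) w = 1 := by
  have h : profile g =ᶠ[nhds w] id := by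
    filter_upwards [Ioi_mem_nhds hw] with x hx
    have hx : 2 < x := hx
    have hx' : |x| = x := abs_of_pos (by linarith)
    rw [hg.profile_of_two_le (by linarith), hx', id]
  rw [h.deriv_eq, deriv_id]

theorem deriv_profile_of_two_le (hg : IsCutoff δ g) {w : ℝ} (hw : 2 ≤ w) :
    deriv (profile g) w = 1 := by
  have hc : Continuous (deriv (profile g)) := hg.contDiff_deriv_profile.continuous
  have hcl : IsClosed {x | deriv (profile g) x = 1} := isClosed_eq hc continuous_const
  have hsub : Ioi (2 : ℝ) ⊆ {x | deriv (profile g) x = 1} :=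
    fun x hx => hg.deriv_profile_of_two_lt hx
  have := hcl.closure_subset_iff.mpr hsub
  rw [closure_Ioi] at this
  exact this hw

theorem deriv_profile_nonneg (hg : IsCutoff δ g) {w : ℝ} (hw : 0 ≤ w) :
    0 ≤ deriv (profile g) w := by
  have hmono : MonotoneOn (profile g) (Ici 0) := by
    intro a ha c hc hac
    have ha : 0 ≤ a := ha
    have hc : 0 ≤ c := hc
    obtain ⟨-, -, hm, hI, h01, -⟩ := id hg
    rcases le_total a 1 with h1 | h1
    · rw [hg.profile_of_abs_le_one (by rwa [abs_of_nonneg ha])]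
      rcases le_total c 1 with h2 | h2
      · rw [hg.profile_of_abs_le_one (by rwa [abs_of_nonneg hc])]
      · rw [profile, abs_of_nonneg hc]
        nlinarith [mul_nonneg (hI c hc).1 (sub_nonneg.mpr h2)]
    · rw [profile, profile, abs_of_nonneg ha, abs_of_nonneg hc]
      have := mul_le_mul (hm ha hc hac) (sub_le_sub_right hac 1) (sub_nonneg.mpr h1) (hI c hc).1
      linarith
  have h := hmono.derivWithin_nonneg (x := w)
  rwa [(hg.differentiable_profile w).derivWithin (uniqueDiffOn_Ici 0 w hw)] at h

theorem exists_abs_deriv_profile_le (hg : IsCutoff δ g) :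
    ∃ K, 0 ≤ K ∧ ∀ w, |deriv (profile g) w| ≤ K := by
  obtain ⟨K, hK⟩ := isCompact_Icc.exists_bound_of_continuousOn (s := Icc (0 : ℝ) 2)
    hg.contDiff_deriv_profile.continuous.continuousOn
  have key : ∀ w, 0 ≤ w → |deriv (profile g) w| ≤ max K 1 := by
    intro w hw
    rcases le_total w 2 with h | h
    · exact (hK w ⟨hw, h⟩).trans (le_max_left _ _)
    · rw [hg.deriv_profile_of_two_le h, abs_one]
      exact le_max_right _ _
  refine ⟨max K 1, zero_le_one.trans (le_max_right _ _), fun w => ?_⟩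
  rcases le_total 0 w with h | h
  · exact key w h
  · have := key (-w) (by linarith)
    rwa [deriv_profile_neg, abs_neg] at this

theorem deriv_deriv_profile_of_two_lt_abs (hg : IsCutoff δ g) {w : ℝ} (hw : 2 < |w|) :
    deriv (deriv (profile g)) w = 0 := by
  rcases lt_abs.mp hw with h | h
  · have h' : deriv (profile g) =ᶠ[nhds w] fun _ => 1 := by
      filter_upwards [Ioi_mem_nhds h] with x hx
      exact hg.deriv_profile_of_two_lt hx
    rw [h'.deriv_eq, deriv_const]
  · have h' : deriv (profile g) =ᶠ[nhds w] fun _ => -1 := by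
      filter_upwards [Iio_mem_nhds (show w < -2 by linarith)] with x hx
      have hx : x < -2 := hx
      have := hg.deriv_profile_of_two_lt (show 2 < -x by linarith)
      rw [deriv_profile_neg] at this
      linarith
    rw [h'.deriv_eq, deriv_const]

theorem exists_abs_deriv_deriv_profile_le (hg : IsCutoff δ g) :
    ∃ K, 0 ≤ K ∧ ∀ w, |deriv (deriv (profile g)) w| ≤ K := by
  have hc : Continuous (deriv (deriv (profile g))) :=
    hg.contDiff_deriv_profile.continuous_deriv (by norm_num)
  obtain ⟨K, hK⟩ := isCompact_Icc.exists_bound_of_continuousOn (s := Icc (-2 : ℝ) 2)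
    hc.continuousOn
  have hK0 : 0 ≤ K := (norm_nonneg _).trans (hK 0 ⟨by norm_num, by norm_num⟩)
  refine ⟨K, hK0, fun w => ?_⟩
  rcases le_or_gt |w| 2 with h | h
  · exact hK w (abs_le.mp h)
  · rw [hg.deriv_deriv_profile_of_two_lt_abs h, abs_zero]
    exact hK0

theorem exists_abs_profile_sub_le (hg : IsCutoff δ g) :
    ∃ K, 0 ≤ K ∧ ∀ r, 0 ≤ r → |profile g r - r * deriv (profile g) r| ≤ K := by
  have hc : Continuous fun r => profile g r - r * deriv (profile g) r :=
    hg.contDiff_profile.continuous.sub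
      (continuous_id.mul hg.contDiff_deriv_profile.continuous)
  obtain ⟨K, hK⟩ := isCompact_Icc.exists_bound_of_continuousOn (s := Icc (0 : ℝ) 2)
    hc.continuousOn
  have hK0 : 0 ≤ K := (norm_nonneg _).trans (hK 0 ⟨le_rfl, by norm_num⟩)
  refine ⟨K, hK0, fun r hr => ?_⟩
  rcases le_total r 2 with h | h
  · exact hK r ⟨hr, h⟩
  · rw [hg.deriv_profile_of_two_le h,
      hg.profile_of_two_le (by rwa [abs_of_nonneg hr]), abs_of_nonneg hr]
    simpa using hK0

theorem exists_abs_profile_taylor_le (hg : IsCutoff δ g) :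
    ∃ K, 0 ≤ K ∧ ∀ a h, 0 ≤ h →
      |profile g (a + h) - profile g a - deriv (profile g) a * h| ≤ K * min (h ^ 2) h := by
  obtain ⟨K₁, hK₁, h₁⟩ := hg.exists_abs_deriv_profile_le
  obtain ⟨K₂, hK₂, h₂⟩ := hg.exists_abs_deriv_deriv_profile_le
  refine ⟨2 * K₁ + K₂, by positivity, fun a h hh => ?_⟩
  have hder : ∀ x, HasDerivAt (fun x => profile g x - deriv (profile g) a * x)
      (deriv (profile g) x - deriv (profile g) a) x := by
    intro x
    have h := (hg.differentiable_profile x).hasDerivAt.sub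
      ((hasDerivAt_id x).const_mul (deriv (profile g) a))
    rw [mul_one] at h
    exact h
  have mvt : ∀ B, (∀ x ∈ Icc a (a + h), |deriv (profile g) x - deriv (profile g) a| ≤ B) →
      |profile g (a + h) - profile g a - deriv (profile g) a * h| ≤ B * h := by
    intro B hB
    have := (convex_Icc a (a + h)).norm_image_sub_le_of_norm_hasDerivWithin_le
      (fun x _ => (hder x).hasDerivWithinAt) hB (left_mem_Icc.mpr (by linarith))
      (right_mem_Icc.mpr (by linarith))
    rw [Real.norm_eq_abs, Real.norm_eq_abs, add_sub_cancel_left, abs_of_nonneg hh] at this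
    refine le_trans (le_of_eq ?_) this
    congr 1
    ring
  rcases min_choice (h ^ 2) h with hm | hm <;> rw [hm]
  · refine (mvt (K₂ * h) fun x hx => ?_).trans ?_
    · have := convex_univ.norm_image_sub_le_of_norm_deriv_le
        (fun x _ => hg.differentiable_deriv_profile x) (fun x _ => h₂ x) (mem_univ a) (mem_univ x)
      rw [Real.norm_eq_abs, Real.norm_eq_abs, abs_of_nonneg (sub_nonneg.mpr hx.1)] at this
      exact this.trans (mul_le_mul_of_nonneg_left (by linarith [hx.2]) hK₂)
    · nlinarith [mul_nonneg hK₁ (sq_nonneg h)]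
  · refine (mvt (2 * K₁) fun x _ => ?_).trans ?_
    · linarith [abs_sub (deriv (profile g) x) (deriv (profile g) a), h₁ x, h₁ a]
    · nlinarith [mul_nonneg hK₂ hh]

theorem D1_Fcut (hg : IsCutoff δ g) {s t : ℝ} (hs : 0 < s) (ht : 0 ≤ t) :
    D1 (Fcut g) s t = profile g (t / s) - t / s * deriv (profile g) (t / s) := by
  have h : (fun a => Fcut g a t) =ᶠ[nhds s] fun a => a * profile g (t / a) := by
    filter_upwards [Ioi_mem_nhds hs] with a ha
    exact Fcut_eq_mul_profile g ha ht
  have hd := hasDerivAt_const_div t hs.ne'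
  have h2 := (hasDerivAt_id s).mul ((hg.differentiable_profile (t / s)).hasDerivAt.comp s hd)
  rw [D1, h.deriv_eq]
  refine (h2.deriv).trans ?_
  simp only [Function.comp, id]
  field_simp
  ring

theorem D11_Fcut (hg : IsCutoff δ g) {s t : ℝ} (hs : 0 < s) (ht : 0 ≤ t) :
    D11 (Fcut g) s t = (t / s) ^ 2 * deriv (deriv (profile g)) (t / s) * s⁻¹ := by
  have h : (fun a => D1 (Fcut g) a t) =ᶠ[nhds s]
      fun a => profile g (t / a) - t / a * deriv (profile g) (t / a) := by
    filter_upwards [Ioi_mem_nhds hs] with a ha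
    exact hg.D1_Fcut ha ht
  have hd := hasDerivAt_const_div t hs.ne'
  have h2 := ((hg.differentiable_profile (t / s)).hasDerivAt.comp s hd).sub
    (hd.mul ((hg.differentiable_deriv_profile (t / s)).hasDerivAt.comp s hd))
  rw [D11, h.deriv_eq]
  refine (h2.deriv).trans ?_
  simp only [Function.comp]
  field_simp
  ring

theorem D2_Fcut (hg : IsCutoff δ g) {s t : ℝ} (hs : 0 < s) (ht : 0 ≤ t) :
    D2 (Fcut g) s t = deriv (profile g) (t / s) := by
  have h1 : HasDerivAt (fun a => s * profile g (a / s)) (deriv (profile g) (t / s)) t := by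
    have hd : HasDerivAt (fun a => a / s) (1 / s) t := (hasDerivAt_id t).div_const s
    have h2 := ((hg.differentiable_profile (t / s)).hasDerivAt.comp t hd).const_mul s
    refine h2.congr_deriv ?_
    field_simp
  have h2 : HasDerivWithinAt (fun a => Fcut g s a) (deriv (profile g) (t / s)) (Ici 0) t :=
    h1.hasDerivWithinAt.congr (fun a ha => Fcut_eq_mul_profile g hs ha)
      (Fcut_eq_mul_profile g hs ht)
  rw [D2]
  rcases ht.eq_or_lt with rfl | htpos
  · by_cases hdiff : DifferentiableAt ℝ (fun a => Fcut g s a) 0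
    · exact (uniqueDiffOn_Ici (0 : ℝ) 0 self_mem_Ici).eq_deriv _
        hdiff.hasDerivAt.hasDerivWithinAt h2
    · rw [deriv_zero_of_not_differentiableAt hdiff, zero_div, deriv_profile_zero]
  · exact (h2.hasDerivAt (Ici_mem_nhds htpos)).deriv

theorem compensated_increment_eq (hg : IsCutoff δ g) {u : ℝ} (hu : 0 < u) (x xt z : ℝ) :
    Fcut g u |x - xt + z| - Fcut g u |x - xt| - D2 (Fcut g) u |x - xt| * sgn' x xt * z
      = u * (profile g ((x - xt) / u + z / u) - profile g ((x - xt) / u)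
        - deriv (profile g) ((x - xt) / u) * (z / u)) := by
  have habs : ∀ w, |w| / u = |w / u| := fun w => by rw [abs_div, abs_of_pos hu]
  have hd : deriv (profile g) (|x - xt| / u) * sgn' x xt
      = deriv (profile g) ((x - xt) / u) := by
    rcases lt_trichotomy (x - xt) 0 with h | h | h
    · rw [sgn', if_neg (by rintro rfl; simp at h), abs_of_neg h, neg_div, deriv_profile_neg,
        div_neg, div_self h.ne]
      ring
    · simp [sgn', h, deriv_profile_zero]
    · rw [sgn', if_neg (by rintro rfl; simp at h), abs_of_pos h, div_self h.ne', mul_one]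
  rw [Fcut_eq_mul_profile g hu (abs_nonneg _), Fcut_eq_mul_profile g hu (abs_nonneg _),
    hg.D2_Fcut hu (abs_nonneg _), hd, habs, habs, profile_abs, profile_abs, add_div]
  field_simp

end IsCutoff

theorem integrableOn_min_sq_mul_rpow {α : ℝ} (hα : α ∈ Ioo (1 : ℝ) 2) :
    IntegrableOn (fun z : ℝ => min (z ^ 2) z * z ^ (-(1 + α))) (Ioi 0) := by
  have hmeas : Measurable fun z : ℝ => min (z ^ 2) z * z ^ (-(1 + α)) := by fun_prop
  rw [← Ioo_union_Ici_eq_Ioi (zero_lt_one (α := ℝ)), integrableOn_union,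
    integrableOn_Ici_iff_integrableOn_Ioi]
  constructor
  · have h : IntegrableOn (fun z : ℝ => z ^ (1 - α)) (Ioo 0 1) :=
      (intervalIntegral.integrableOn_Ioo_rpow_iff one_pos).mpr (by linarith [hα.2])
    refine h.mono' hmeas.aestronglyMeasurable ?_
    filter_upwards [ae_restrict_mem measurableSet_Ioo] with z hz
    have hz0 : 0 < z := hz.1
    rw [Real.norm_of_nonneg (by positivity)]
    calc min (z ^ 2) z * z ^ (-(1 + α)) ≤ z ^ 2 * z ^ (-(1 + α)) := by
          gcongr
          exact min_le_left _ _
      _ = z ^ (1 - α) := by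
          rw [← Real.rpow_natCast, ← Real.rpow_add hz0]
          congr 1
          push_cast
          ring
  · have h : IntegrableOn (fun z : ℝ => z ^ (-α)) (Ioi 1) :=
      integrableOn_Ioi_rpow_of_lt (by linarith [hα.1]) one_pos
    refine h.mono' hmeas.aestronglyMeasurable ?_
    filter_upwards [ae_restrict_mem measurableSet_Ioi] with z hz
    have hz0 : 0 < z := one_pos.trans hz
    rw [Real.norm_of_nonneg (by positivity)]
    calc min (z ^ 2) z * z ^ (-(1 + α)) ≤ z * z ^ (-(1 + α)) := by
          gcongr
          exact min_le_right _ _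
      _ = z ^ (-α) := by
          nth_rewrite 1 [← Real.rpow_one z]
          rw [← Real.rpow_add hz0]
          congr 1
          ring

theorem integral_nuMeasure {Cα : ℝ} (hCα : 0 ≤ Cα) (α : ℝ) (f : ℝ → ℝ) :
    ∫ z, f z ∂nuMeasure Cα α = ∫ z in Ioi 0, Cα * z ^ (-(1 + α)) * f z := by
  rw [nuMeasure, integral_withDensity_eq_integral_toReal_smul (by fun_prop)
    (Filter.Eventually.of_forall fun _ => ENNReal.ofReal_lt_top)]
  refine setIntegral_congr_fun measurableSet_Ioi fun z hz => ?_
  have hz : 0 < z := hz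
  simp only [smul_eq_mul]
  rw [ENNReal.toReal_ofReal (by positivity)]

theorem abs_integral_nuMeasure_le {α Cα u K : ℝ} (hα : α ∈ Ioo (1 : ℝ) 2) (hCα : 0 ≤ Cα)
    (hu : 0 < u) {f : ℝ → ℝ} (hf : ∀ z, 0 < z → |f z| ≤ K * min ((z / u) ^ 2) (z / u)) :
    |∫ z, f z ∂nuMeasure Cα α|
      ≤ K * Cα * u ^ (-α) * ∫ z in Ioi (0 : ℝ), min (z ^ 2) z * z ^ (-(1 + α)) := by
  set m : ℝ → ℝ := fun z => min (z ^ 2) z * z ^ (-(1 + α)) with hm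
  have hu' : 0 < u⁻¹ := inv_pos.mpr hu
  have hint : IntegrableOn (fun z => K * Cα * u ^ (-(1 + α)) * m (u⁻¹ * z)) (Ioi 0) := by
    refine Integrable.const_mul ?_ _
    have := (integrableOn_Ioi_comp_mul_left_iff m 0 hu').mpr
    rw [mul_zero] at this
    exact this (integrableOn_min_sq_mul_rpow hα)
  have hval : ∫ z in Ioi (0 : ℝ), K * Cα * u ^ (-(1 + α)) * m (u⁻¹ * z)
      = K * Cα * u ^ (-α) * ∫ z in Ioi (0 : ℝ), m z := by
    rw [integral_const_mul, integral_comp_mul_left_Ioi m 0 hu', mul_zero, inv_inv, smul_eq_mul]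
    have : u ^ (-α) = u ^ (-(1 + α)) * u := by
      nth_rewrite 3 [← Real.rpow_one u]
      rw [← Real.rpow_add hu]
      congr 1
      ring
    rw [this]
    ring
  rw [integral_nuMeasure hCα, ← hval, ← Real.norm_eq_abs]
  refine norm_integral_le_of_norm_le hint ?_
  filter_upwards [ae_restrict_mem measurableSet_Ioi] with z hz
  have hz : 0 < z := hz
  have hpow : u ^ (-(1 + α)) * (u⁻¹ * z) ^ (-(1 + α)) = z ^ (-(1 + α)) := by
    rw [← Real.mul_rpow hu.le (by positivity), mul_inv_cancel_left₀ hu.ne']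
  have hdiv : z / u = u⁻¹ * z := by ring
  rw [Real.norm_eq_abs, abs_mul, abs_of_nonneg (by positivity)]
  calc Cα * z ^ (-(1 + α)) * |f z|
      ≤ Cα * z ^ (-(1 + α)) * (K * min ((u⁻¹ * z) ^ 2) (u⁻¹ * z)) := by
        have := hf z hz
        rw [hdiv] at this
        gcongr
    _ = K * Cα * u ^ (-(1 + α)) * m (u⁻¹ * z) := by
        rw [hm, ← hpow]
        ring

theorem IsCutoff.exists_abs_D11_Fcut_le {δ : ℝ} {g : ℝ → ℝ} (hg : IsCutoff δ g) :
    ∃ K, 0 ≤ K ∧ ∀ s t, 0 < s → 0 ≤ t → |D11 (Fcut g) s t| ≤ K * s⁻¹ := by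
  obtain ⟨K, hK, h⟩ := hg.exists_abs_deriv_deriv_profile_le
  refine ⟨4 * K, by positivity, fun s t hs ht => ?_⟩
  rw [hg.D11_Fcut hs ht, abs_mul, abs_of_pos (inv_pos.mpr hs)]
  gcongr
  have hr : 0 ≤ t / s := by positivity
  rcases le_or_gt (t / s) 2 with h2 | h2
  · rw [abs_mul, abs_of_nonneg (sq_nonneg _)]
    exact mul_le_mul (by nlinarith) (h _) (abs_nonneg _) (by norm_num)
  · rw [hg.deriv_deriv_profile_of_two_lt_abs (by rwa [abs_of_nonneg hr])]
    simpa using hK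

theorem IsCutoff.exists_mul_integral_le {α Cα δ : ℝ} {g : ℝ → ℝ} (hg : IsCutoff δ g)
    (hα : α ∈ Ioo (1 : ℝ) 2) (hCα : 0 ≤ Cα) :
    ∃ K, 0 ≤ K ∧ ∀ u x xt, 0 < u →
      u * ∫ z, (Fcut g u |x - xt + z| - Fcut g u |x - xt|
        - D2 (Fcut g) u |x - xt| * sgn' x xt * z) ∂nuMeasure Cα α ≤ K * u ^ (2 - α) := by
  obtain ⟨K, hK, h⟩ := hg.exists_abs_profile_taylor_le
  set I := ∫ z in Ioi (0 : ℝ), min (z ^ 2) z * z ^ (-(1 + α))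
  have hI : 0 ≤ I := setIntegral_nonneg measurableSet_Ioi fun z hz => by
    have hz : 0 < z := hz
    positivity
  refine ⟨K * Cα * I, by positivity, fun u x xt hu => ?_⟩
  have hb := abs_integral_nuMeasure_le (K := u * K) hα hCα hu
    (f := fun z => Fcut g u |x - xt + z| - Fcut g u |x - xt|
        - D2 (Fcut g) u |x - xt| * sgn' x xt * z) fun z hz => by
      rw [hg.compensated_increment_eq hu, abs_mul, abs_of_pos hu, mul_assoc]
      exact mul_le_mul_of_nonneg_left (h _ _ (by positivity)) hu.le
  have hpow : u ^ (2 - α) = u * u * u ^ (-α) := by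
    rw [sub_eq_add_neg, Real.rpow_add hu, Real.rpow_two, sq]
  calc _ ≤ u * (u * K * Cα * u ^ (-α) * I) :=
        mul_le_mul_of_nonneg_left ((le_abs_self _).trans hb) hu.le
    _ = K * Cα * I * u ^ (2 - α) := by
        rw [hpow]
        ring

/-- Inequality \eqref{PP}: there exists `C > 0` such that for all `y > ỹ ≥ 0`
and `x, x̃ ∈ ℝ`, with `u = y - ỹ`, `v = |x - x̃|`,
`(L*F)(y,ỹ,x,x̃) ≤ -λ v 1_{v ≥ 2u} + C u + (C/2) u^{2-α}
  + (C/2)(√y + √ỹ)² u⁻¹ 1_{0<u<1} + (C/2)(√y - √ỹ)² u⁻¹ 1_{u≥1}`. -/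
theorem stmt6 (b lam α Cα δ : ℝ) (hb : 0 < b) (hlam : 0 < lam)
    (hα : α ∈ Ioo (1 : ℝ) 2) (hCα : 0 < Cα) (hδ : 0 < δ)
    (g : ℝ → ℝ) (hg : IsCutoff δ g) :
    ∃ C : ℝ, 0 < C ∧ ∀ y yt x xt : ℝ, 0 ≤ yt → yt < y →
      Lstar b lam Cα α (Fcut g) y yt x xt
        ≤ -lam * |x - xt| * (if 2 * (y - yt) ≤ |x - xt| then 1 else 0)
          + C * (y - yt) + (C / 2) * (y - yt) ^ (2 - α)
          + (C / 2) * (Real.sqrt y + Real.sqrt yt) ^ 2 * (y - yt)⁻¹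
              * (if 0 < y - yt ∧ y - yt < 1 then 1 else 0)
          + (C / 2) * (Real.sqrt y - Real.sqrt yt) ^ 2 * (y - yt)⁻¹
              * (if 1 ≤ y - yt then 1 else 0) := by
  obtain ⟨K₁, hK₁, h₁⟩ := hg.exists_abs_profile_sub_le
  obtain ⟨K₂, hK₂, h₂⟩ := hg.exists_abs_D11_Fcut_le
  obtain ⟨K₃, hK₃, h₃⟩ := hg.exists_mul_integral_le hα hCα.le
  refine ⟨1 + b * K₁ + K₂ + 2 * K₃, by positivity, fun y yt x xt _ hlt => ?_⟩
  set C := 1 + b * K₁ + K₂ + 2 * K₃ with hC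
  have hbK : 0 ≤ b * K₁ := by positivity
  have hu : 0 < y - yt := sub_pos.mpr hlt
  have hv : 0 ≤ |x - xt| := abs_nonneg _
  rw [Lstar]
  have hint := h₃ (y - yt) x xt hu
  generalize y - yt = u at *
  have drift : -b * u * D1 (Fcut g) u |x - xt| ≤ C * u := by
    have h := h₁ (|x - xt| / u) (by positivity)
    rw [← hg.D1_Fcut hu hv] at h
    nlinarith [mul_nonneg (mul_pos hb hu).le (sub_nonneg.mpr (neg_le_of_abs_le h)),
      mul_nonneg hK₂ hu.le, mul_nonneg hK₃ hu.le]
  have diffusion : ∀ S q : ℝ, 0 ≤ S → 0 ≤ q →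
      (1 / 2) * S * D11 (Fcut g) u |x - xt| * q ≤ (C / 2) * S * u⁻¹ * q := by
    intro S q hS hq
    have h : D11 (Fcut g) u |x - xt| ≤ C * u⁻¹ :=
      (le_abs_self _).trans ((h₂ u _ hu hv).trans (by gcongr; linarith))
    have := mul_le_mul_of_nonneg_left h (show 0 ≤ 1 / 2 * S * q by positivity)
    linarith
  have contraction : -(lam * |x - xt| * D2 (Fcut g) u |x - xt|)
      ≤ -lam * |x - xt| * (if 2 * u ≤ |x - xt| then 1 else 0) := by
    rw [hg.D2_Fcut hu hv]
    split_ifs with h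
    · rw [hg.deriv_profile_of_two_le ((le_div_iff₀ hu).mpr h)]
      linarith
    · have := hg.deriv_profile_nonneg (show 0 ≤ |x - xt| / u by positivity)
      have := mul_nonneg (mul_nonneg hlam.le hv) this
      linarith
  have jumps : K₃ * u ^ (2 - α) ≤ C / 2 * u ^ (2 - α) := by
    gcongr
    linarith
  have d1 := diffusion ((√y + √yt) ^ 2) (if 0 < u ∧ u < 1 then 1 else 0) (sq_nonneg _)
    (by split_ifs <;> norm_num)
  have d2 := diffusion ((√y - √yt) ^ 2) (if 1 ≤ u then 1 else 0) (sq_nonneg _)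
    (by split_ifs <;> norm_num)
  linarith
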